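/- Dual orthogonality relation for the bivariate quantum q-Krawtchouk polynomials: for every real q with 0 < q < 1, every positive integer N, all nonzero real numbers θ, φ such that θ² ≠ q^j and φ² ≠ q^j for every integer j with 1 ≤ j ≤ N, and all integers x₁, x₂, y₁, y₂ ≥ 0 with x₁+x₂ ≤ N and y₁+y₂ ≤ N, one has Δ^{(N)}_{x₁,x₂}(θ,φ) · Σ_{n₁,n₂ ≥ 0, n₁+n₂ ≤ N} Δ̃^{(N)}_{n₁,n₂}(θ,φ) · K_{n₁,n₂}(x₁,x₂;θ,φ;N) · K_{n₁,n₂}(y₁,y₂;θ,φ;N) = δ_{x₁ y₁} δ_{x₂ y₂}. -/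

import Mathlib

open Finset

/-- The q-Pochhammer symbol `(a;q)_n = ∏_{k=0}^{n-1} (1 - a q^k)`. -/
noncomputable def qPoch (q a : ℝ) (n : ℕ) : ℝ := ∏ k ∈ Finset.range n, (1 - a * q ^ k)

/-- The quantum q-Krawtchouk polynomial `k_n(x;p,N;q)`, defined for all integers `x, N`. -/
noncomputable def qKraw (q : ℝ) (n : ℕ) (x N : ℤ) (p : ℝ) : ℝ :=
  (-1 : ℝ) ^ n * q ^ (n * (n - 1) / 2) *
    ∑ k ∈ Finset.range (n + 1),
      qPoch q (q ^ (-(n : ℤ))) k * qPoch q (q ^ (-x)) k *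
        qPoch q (q ^ ((k : ℤ) - N)) (n - k) / qPoch q q k * (p * q ^ (n + 1)) ^ k

/-- The bivariate quantum q-Krawtchouk polynomial of Gasper and Rahman,
`K_{n₁,n₂}(x₁,x₂;θ,φ;N) = k_{n₁}(x₁;θ^{-2},x₁+x₂;q) k_{n₂}(x₁+x₂-n₁;φ^{-2},N-n₁;q)`,
with the convention that it vanishes when a degree index is negative. -/
noncomputable def Kq (q : ℝ) (n₁ n₂ x₁ x₂ : ℤ) (θ φ : ℝ) (N : ℤ) : ℝ :=
  if 0 ≤ n₁ ∧ 0 ≤ n₂ then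
    qKraw q n₁.toNat x₁ (x₁ + x₂) (θ ^ 2)⁻¹ *
      qKraw q n₂.toNat (x₁ + x₂ - n₁) (N - n₁) (φ ^ 2)⁻¹
  else 0

/-- The q-trinomial coefficient `[N; x₁, x₂]_q`. -/
noncomputable def qTrinom (q : ℝ) (N x₁ x₂ : ℕ) : ℝ :=
  qPoch q q N / (qPoch q q x₁ * qPoch q q x₂ * qPoch q q (N - x₁ - x₂))

/-- The orthogonality weight `Δ^{(N)}_{x₁,x₂}(θ,φ)`. -/
noncomputable def Δw (q : ℝ) (N x₁ x₂ : ℕ) (θ φ : ℝ) : ℝ :=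
  (-1 : ℝ) ^ (N - x₁) * (θ ^ 2 * q⁻¹) ^ (x₁ + x₂) * q ^ (x₁ * (x₁ - 1) / 2) *
    qTrinom q N x₁ x₂ * qPoch q ((θ ^ 2)⁻¹ * q) x₂ * qPoch q ((φ ^ 2)⁻¹ * q) (N - x₁ - x₂) *
    φ ^ (2 * N) * q ^ (-((N : ℤ) * (N + 1) / 2))

/-- The normalization constant `H^{(N)}_{n₁,n₂}(θ,φ)`. -/
noncomputable def Hn (q : ℝ) (N n₁ n₂ : ℕ) (θ φ : ℝ) : ℝ :=
  (-1 : ℝ) ^ (n₁ + n₂) * qPoch q (q * (θ ^ 2)⁻¹) n₁ * qPoch q (q * (φ ^ 2)⁻¹) n₂ *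
    φ ^ (2 * n₁) * (qPoch q q N / qPoch q q (N - n₁ - n₂)) ^ 2 * (qTrinom q N n₁ n₂)⁻¹ *
    q ^ (3 * ((n₁ : ℤ) * (n₁ - 1)) / 2 + 3 * ((n₂ : ℤ) * (n₂ - 1)) / 2 +
          (n₁ : ℤ) * n₂ - (N : ℤ) * (n₁ + n₂) - 2 * n₁ - n₂)

/-- The dual weight `Δ̃^{(N)}_{n₁,n₂}(θ,φ)`. -/
noncomputable def Δdual (q : ℝ) (N n₁ n₂ : ℕ) (θ φ : ℝ) : ℝ :=
  (-1 : ℝ) ^ (n₁ + n₂) * q ^ (-((n₁ : ℤ) * (n₁ - 1)) - (n₂ : ℤ) * (n₂ - 1)) *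
    φ ^ (-(2 * (n₁ : ℤ))) * (qPoch q q (N - n₁ - n₂) / qPoch q q N) ^ 2 * qTrinom q N n₁ n₂ *
    q ^ ((N : ℤ) * (n₁ + n₂) + 2 * n₁ + n₂ - (n₁ : ℤ) * n₂ -
          (n₁ : ℤ) * (n₁ - 1) / 2 - (n₂ : ℤ) * (n₂ - 1) / 2) /
    (qPoch q (q * (θ ^ 2)⁻¹) n₁ * qPoch q (q * (φ ^ 2)⁻¹) n₂)

lemma qPoch_zero (q a : ℝ) : qPoch q a 0 = 1 := by simp [qPoch]

lemma qPoch_succ (q a : ℝ) (n : ℕ) : qPoch q a (n + 1) = qPoch q a n * (1 - a * q ^ n) :=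
  Finset.prod_range_succ _ _

lemma qPoch_succ' (q a : ℝ) (n : ℕ) : qPoch q a (n + 1) = (1 - a) * qPoch q (a * q) n := by
  simp only [qPoch, Finset.prod_range_succ', pow_zero, mul_one]
  rw [mul_comm]
  congr 1
  exact Finset.prod_congr rfl fun k _ => by ring

lemma qPoch_ne_zero {q a : ℝ} {n : ℕ} (h : ∀ k < n, a * q ^ k ≠ 1) : qPoch q a n ≠ 0 :=
  Finset.prod_ne_zero_iff.mpr fun k hk => sub_ne_zero.mpr (h k (Finset.mem_range.mp hk)).symm

lemma qPoch_eq_zero {q a : ℝ} {n k : ℕ} (hk : k < n) (h : a * q ^ k = 1) : qPoch q a n = 0 :=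
  Finset.prod_eq_zero (Finset.mem_range.mpr hk) (by rw [h, sub_self])

lemma qPoch_self_ne_zero {q : ℝ} (hq0 : 0 < q) (hq1 : q < 1) (n : ℕ) : qPoch q q n ≠ 0 :=
  qPoch_ne_zero fun k _ => by
    rw [← pow_succ']
    exact (pow_lt_one₀ hq0.le hq1 k.succ_ne_zero).ne

/-- Recurrence for the prefactor `(-1)^n q^{n(n-1)/2}` of `k_n`. -/
lemma qKraw_prefactor_succ (q : ℝ) (n : ℕ) :
    (-1 : ℝ) ^ (n + 1) * q ^ ((n + 1) * (n + 1 - 1) / 2) =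
      -q ^ n * ((-1 : ℝ) ^ n * q ^ (n * (n - 1) / 2)) := by
  rw [← Nat.choose_two_right, ← Nat.choose_two_right, Nat.choose_succ_succ' n 1, Nat.choose_one_right]
  ring

/-- `k_n(x; p, N; q)` vanishes on `0 ≤ x ≤ N` when its degree exceeds `N`. -/
lemma qKraw_eq_zero {q : ℝ} (hq : q ≠ 0) {n x N : ℕ} (hx : x ≤ N) (hn : N < n) (p : ℝ) :
    qKraw q n x N p = 0 := by
  unfold qKraw
  rw [Finset.sum_eq_zero, mul_zero]
  intro k hk
  rcases lt_or_ge x k with h | h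
  · rw [qPoch_eq_zero (a := q ^ (-(x : ℤ))) h]
    · simp
    · rw [zpow_neg, zpow_natCast, inv_mul_cancel₀ (pow_ne_zero _ hq)]
  · rw [qPoch_eq_zero (a := q ^ ((k : ℤ) - N)) (k := N - k) (by omega)]
    · simp
    · rw [← zpow_natCast, ← zpow_add₀ hq, Nat.cast_sub (by omega)]
      simp

/-- The lowering relation for the quantum q-Krawtchouk polynomials. -/
lemma qKraw_lower {q : ℝ} (hq0 : 0 < q) (hq1 : q < 1) (n : ℕ) (x N : ℤ) (p : ℝ) :
    q ^ (x + 1) * (qKraw q (n + 1) (x + 1) (N + 1) p - qKraw q (n + 1) x (N + 1) p) =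
      -(1 - q ^ (n + 1)) * p * q ^ (n + 1) * qKraw q n x N (p * q) := by
  have hq : q ≠ 0 := hq0.ne'
  unfold qKraw
  rw [qKraw_prefactor_succ, ← mul_sub, ← Finset.sum_sub_distrib, Finset.sum_range_succ']
  simp only [qPoch_zero, pow_zero, mul_one, sub_self, add_zero, Finset.mul_sum]
  refine Finset.sum_congr rfl fun k hk => ?_
  have e1 : qPoch q (q ^ (-((n + 1 : ℕ) : ℤ))) (k + 1) =
      (1 - q ^ (-((n + 1 : ℕ) : ℤ))) * qPoch q (q ^ (-(n : ℤ))) k := by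
    rw [qPoch_succ', ← zpow_add_one₀ hq]; congr 3; push_cast; ring
  have e2 : qPoch q (q ^ (-(x + 1))) (k + 1) = (1 - q ^ (-(x + 1))) * qPoch q (q ^ (-x)) k := by
    rw [qPoch_succ', ← zpow_add_one₀ hq]; congr 3; ring
  have e3 : ((k + 1 : ℕ) : ℤ) - (N + 1) = k - N := by push_cast; ring
  have e4 : n + 1 - (k + 1) = n - k := by omega
  have h1 := qPoch_self_ne_zero hq0 hq1 k
  have h2 := qPoch_self_ne_zero hq0 hq1 (k + 1)
  rw [qPoch_succ] at h2
  have h3 := right_ne_zero_of_mul h2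
  rw [e1, e2, e3, e4, qPoch_succ q (q ^ (-x)), qPoch_succ q q]
  simp only [zpow_neg, zpow_add₀ hq, zpow_one, zpow_natCast, pow_succ q n]
  have h4 : q ^ x ≠ 0 := zpow_ne_zero _ hq
  have h5 : q ^ n ≠ 0 := pow_ne_zero _ hq
  generalize q ^ x = X at *
  field_simp
  ring

lemma qPoch_index_step {q : ℝ} (hq : q ≠ 0) {n k : ℕ} (hk : k ≤ n) (N : ℤ) :
    (q ^ (k + 1) - q ^ (N + 1)) * (qPoch q (q ^ (-(n : ℤ))) (k + 1) *
        qPoch q (q ^ (((k + 1 : ℕ) : ℤ) - N)) (n - (k + 1))) =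
      -q ^ (N + 1) * (1 - q ^ (-(n : ℤ)) * q ^ k) * (qPoch q (q ^ (-(n : ℤ))) k *
        qPoch q (q ^ ((k : ℤ) - N)) (n - k)) := by
  rw [qPoch_succ]
  rcases hk.eq_or_lt with rfl | h
  · simp [hq]
  · obtain ⟨j, rfl⟩ := Nat.exists_eq_add_of_lt h
    rw [show k + j + 1 - (k + 1) = j by omega, show k + j + 1 - k = j + 1 by omega,
      qPoch_succ' q (q ^ ((k : ℤ) - N)), ← zpow_add_one₀ hq,
      show (k : ℤ) - N + 1 = ((k + 1 : ℕ) : ℤ) - N by push_cast; ring]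
    have : q ^ (k + 1) - q ^ (N + 1) = -q ^ (N + 1) * (1 - q ^ ((k : ℤ) - N)) := by
      rw [zpow_sub₀ hq, zpow_add_one₀ hq, zpow_natCast]
      have h4 : q ^ N ≠ 0 := zpow_ne_zero _ hq
      field_simp
      ring
    rw [this]
    ring

/-- The raising relation for the quantum q-Krawtchouk polynomials. -/
lemma qKraw_raise {q : ℝ} (hq0 : 0 < q) (hq1 : q < 1) (n : ℕ) (x N : ℤ) (p : ℝ) :
    q * (1 - p * q ^ (N + 2 - x)) * (1 - q ^ x) * qKraw q n (x - 1) N (p * q) +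
        q ^ (x + 1) * (1 - q ^ (N + 1 - x)) * qKraw q n x N (p * q) =
      q ^ (N + 2 - n) * qKraw q (n + 1) x (N + 1) p := by
  have hq : q ≠ 0 := hq0.ne'
  have hX : q ^ x ≠ 0 := zpow_ne_zero _ hq
  have hNz : q ^ N ≠ 0 := zpow_ne_zero _ hq
  have hφ : ∀ k : ℕ, q * (1 - p * q ^ (N + 2 - x)) * (1 - q ^ x) * qPoch q (q ^ (-(x - 1))) k +
      q ^ (x + 1) * (1 - q ^ (N + 1 - x)) * qPoch q (q ^ (-x)) k =
      q * (q ^ k - q ^ (N + 1)) * qPoch q (q ^ (-x)) k +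
        p * q ^ (N + 3) * qPoch q (q ^ (-x)) (k + 1) := by
    intro k
    have e1 : (1 - q ^ x) * qPoch q (q ^ (-(x - 1))) k =
        -q ^ x * (qPoch q (q ^ (-x)) k * (1 - q ^ (-x) * q ^ k)) := by
      rw [← qPoch_succ, qPoch_succ', ← zpow_add_one₀ hq, show -(x - 1) = -x + 1 by ring, zpow_neg]
      field_simp
      ring
    rw [mul_assoc (q * _), e1, qPoch_succ]
    simp only [zpow_sub₀ hq, zpow_neg, zpow_add₀ hq, zpow_ofNat]
    field_simp
    ring
  unfold qKraw
  rw [qKraw_prefactor_succ]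
  set s := (-1 : ℝ) ^ n * q ^ (n * (n - 1) / 2)
  set c : ℕ → ℝ := fun k => qPoch q (q ^ (-(n : ℤ))) k *
    qPoch q (q ^ ((k : ℤ) - N)) (n - k) / qPoch q q k * (p * q * q ^ (n + 1)) ^ k with hc
  have hL : q * (1 - p * q ^ (N + 2 - x)) * (1 - q ^ x) * (s * ∑ k ∈ Finset.range (n + 1),
        qPoch q (q ^ (-(n : ℤ))) k * qPoch q (q ^ (-(x - 1))) k *
        qPoch q (q ^ ((k : ℤ) - N)) (n - k) / qPoch q q k * (p * q * q ^ (n + 1)) ^ k) +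
      q ^ (x + 1) * (1 - q ^ (N + 1 - x)) * (s * ∑ k ∈ Finset.range (n + 1),
        qPoch q (q ^ (-(n : ℤ))) k * qPoch q (q ^ (-x)) k *
        qPoch q (q ^ ((k : ℤ) - N)) (n - k) / qPoch q q k * (p * q * q ^ (n + 1)) ^ k) =
      s * (∑ k ∈ Finset.range (n + 1), c k * (q * (q ^ k - q ^ (N + 1))) * qPoch q (q ^ (-x)) k +
        ∑ k ∈ Finset.range (n + 1), c k * (p * q ^ (N + 3)) * qPoch q (q ^ (-x)) (k + 1)) := by
    rw [← Finset.sum_add_distrib]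
    simp only [Finset.mul_sum]
    rw [← Finset.sum_add_distrib]
    refine Finset.sum_congr rfl fun k _ => ?_
    linear_combination s * c k * hφ k
  have hc0 : c (n + 1) = 0 := by
    rw [hc]
    simp only
    rw [qPoch_eq_zero (a := q ^ (-(n : ℤ))) n.lt_succ_self]
    · simp
    · simp [hq]
  have hext : ∑ k ∈ Finset.range (n + 1), c k * (q * (q ^ k - q ^ (N + 1))) * qPoch q (q ^ (-x)) k =
      ∑ k ∈ Finset.range (n + 1 + 1), c k * (q * (q ^ k - q ^ (N + 1))) * qPoch q (q ^ (-x)) k := by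
    rw [Finset.sum_range_succ _ (n + 1), hc0]
    simp
  rw [hL, hext, Finset.sum_range_succ' _ (n + 1), Finset.sum_range_succ' _ (n + 1),
    add_right_comm, ← Finset.sum_add_distrib]
  have key : ∀ k ∈ Finset.range (n + 1),
      c (k + 1) * (q * (q ^ (k + 1) - q ^ (N + 1))) * qPoch q (q ^ (-x)) (k + 1) +
        c k * (p * q ^ (N + 3)) * qPoch q (q ^ (-x)) (k + 1) =
      -q ^ (N + 2) * (qPoch q (q ^ (-((n + 1 : ℕ) : ℤ))) (k + 1) * qPoch q (q ^ (-x)) (k + 1) *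
        qPoch q (q ^ (((k + 1 : ℕ) : ℤ) - (N + 1))) (n + 1 - (k + 1)) / qPoch q q (k + 1) *
        (p * q ^ (n + 1 + 1)) ^ (k + 1)) := by
    intro k hk
    have hkn : k ≤ n := by simpa [Nat.lt_succ_iff] using hk
    have step := qPoch_index_step hq hkn N
    have e1 : qPoch q (q ^ (-((n + 1 : ℕ) : ℤ))) (k + 1) =
        (1 - q ^ (-((n + 1 : ℕ) : ℤ))) * qPoch q (q ^ (-(n : ℤ))) k := by
      rw [qPoch_succ', ← zpow_add_one₀ hq]; congr 3; push_cast; ring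
    have e3 : ((k + 1 : ℕ) : ℤ) - (N + 1) = k - N := by push_cast; ring
    have e4 : n + 1 - (k + 1) = n - k := by omega
    have h1 := qPoch_self_ne_zero hq0 hq1 k
    have h2 := qPoch_self_ne_zero hq0 hq1 (k + 1)
    have h3 := h2
    rw [qPoch_succ] at h3
    have h4 := right_ne_zero_of_mul h3
    have e5 : c (k + 1) * (q * (q ^ (k + 1) - q ^ (N + 1))) =
        (-q ^ (N + 1) * (1 - q ^ (-(n : ℤ)) * q ^ k) * (qPoch q (q ^ (-(n : ℤ))) k *
        qPoch q (q ^ ((k : ℤ) - N)) (n - k))) * q / qPoch q q (k + 1) *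
          (p * q * q ^ (n + 1)) ^ (k + 1) := by
      rw [← step, hc]
      ring
    rw [e5, e1, e3, e4, qPoch_succ q q, hc]
    simp only [zpow_neg, zpow_natCast, zpow_add₀ hq, zpow_ofNat, pow_succ]
    field_simp
    ring
  rw [Finset.sum_congr rfl key, ← Finset.mul_sum]
  have hzero : c 0 * (q * (q ^ 0 - q ^ (N + 1))) * qPoch q (q ^ (-x)) 0 =
      -q ^ (N + 2) * (qPoch q (q ^ (-((n + 1 : ℕ) : ℤ))) 0 * qPoch q (q ^ (-x)) 0 *
        qPoch q (q ^ (((0 : ℕ) : ℤ) - (N + 1))) (n + 1 - 0) / qPoch q q 0 *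
        (p * q ^ (n + 1 + 1)) ^ 0) := by
    rw [hc]
    simp only [qPoch_zero, pow_zero, Nat.sub_zero, qPoch_succ', ← zpow_add_one₀ hq]
    rw [show ((0 : ℕ) : ℤ) - (N + 1) + 1 = ((0 : ℕ) : ℤ) - N by ring]
    have : q * (1 - q ^ (N + 1)) = -q ^ (N + 2) * (1 - q ^ (((0 : ℕ) : ℤ) - (N + 1))) := by
      rw [Nat.cast_zero, zero_sub]
      simp only [zpow_neg, zpow_add₀ hq, zpow_ofNat]
      field_simp
      ring
    rw [this]
    ring
  have hsplit : q ^ (N + 2) = q ^ (N + 2 - n) * q ^ n := by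
    rw [← zpow_natCast, ← zpow_add₀ hq, sub_add_cancel]
  rw [hzero, hsplit]
  ring

/-- The orthogonality weight of the quantum q-Krawtchouk polynomials `k_n(x; p, N; q)`. -/
noncomputable def qKrawWeight (q p : ℝ) (N x : ℕ) : ℝ :=
  (-1 : ℝ) ^ (N - x) * q ^ x.choose 2 * qPoch q (p * q) (N - x) / (qPoch q q x * qPoch q q (N - x))

/-- The squared norm of `k_n(x; p, N; q)` with respect to `qKrawWeight`. -/
noncomputable def qKrawNorm (q p : ℝ) (N n : ℕ) : ℝ :=
  (-1 : ℝ) ^ n * qPoch q (p * q) n * qPoch q q n * p ^ N *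
    q ^ (((N - n + 1).choose 2 : ℤ) + n * n - 2 * n) / qPoch q q (N - n)

lemma qKrawWeight_ne_zero {q p : ℝ} (hq0 : 0 < q) (hq1 : q < 1) {N x : ℕ}
    (hp : ∀ k < N, p * q * q ^ k ≠ 1) : qKrawWeight q p N x ≠ 0 :=
  div_ne_zero (mul_ne_zero (mul_ne_zero (pow_ne_zero _ (by norm_num)) (pow_ne_zero _ hq0.ne'))
    (qPoch_ne_zero fun k hk => hp k (by omega)))
    (mul_ne_zero (qPoch_self_ne_zero hq0 hq1 _) (qPoch_self_ne_zero hq0 hq1 _))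

lemma qKrawNorm_ne_zero {q p : ℝ} (hq0 : 0 < q) (hq1 : q < 1) {N n : ℕ} (hn : n ≤ N)
    (hp0 : p ≠ 0) (hp : ∀ k < N, p * q * q ^ k ≠ 1) : qKrawNorm q p N n ≠ 0 :=
  div_ne_zero (mul_ne_zero (mul_ne_zero (mul_ne_zero (mul_ne_zero (pow_ne_zero _ (by norm_num))
    (qPoch_ne_zero fun k hk => hp k (by omega))) (qPoch_self_ne_zero hq0 hq1 _))
    (pow_ne_zero _ hp0)) (zpow_ne_zero _ hq0.ne')) (qPoch_self_ne_zero hq0 hq1 _)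

lemma choose_two_succ (n : ℕ) : (n + 1).choose 2 = n + n.choose 2 := by
  rw [Nat.choose_succ_succ' n 1, Nat.choose_one_right]

lemma qKrawWeight_succ_succ {q : ℝ} (hq0 : 0 < q) (hq1 : q < 1) (p : ℝ) {N x : ℕ} (hx : x ≤ N) :
    qKrawWeight q p (N + 1) (x + 1) * ((1 - p * q ^ (N + 1 - x)) * (1 - q ^ (x + 1))) =
      (1 - p * q) * q ^ x * qKrawWeight q (p * q) N x := by
  obtain ⟨j, rfl⟩ := Nat.exists_eq_add_of_le hx
  have h1 := qPoch_self_ne_zero hq0 hq1 j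
  have h2 := qPoch_self_ne_zero hq0 hq1 (x + 1)
  have h := qPoch_succ q (p * q) j
  rw [qPoch_succ'] at h
  rw [qPoch_succ] at h2
  have h3 := left_ne_zero_of_mul h2
  have h4 := right_ne_zero_of_mul h2
  unfold qKrawWeight
  rw [show x + j + 1 - (x + 1) = j by omega, show x + j - x = j by omega,
    show x + j + 1 - x = j + 1 by omega, qPoch_succ q q, choose_two_succ]
  rw [pow_succ' q x, pow_add]
  generalize qPoch q (p * q * q) j = A at *
  generalize 1 - q * q ^ x = D at *
  field_simp
  linear_combination -h

lemma qKrawWeight_succ_left {q : ℝ} (hq0 : 0 < q) (hq1 : q < 1) (p : ℝ) {N x : ℕ} (hx : x ≤ N) :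
    qKrawWeight q p (N + 1) x * (1 - q ^ (N + 1 - x)) =
      -(1 - p * q) * qKrawWeight q (p * q) N x := by
  obtain ⟨j, rfl⟩ := Nat.exists_eq_add_of_le hx
  have h1 := qPoch_self_ne_zero hq0 hq1 x
  have h2 := qPoch_self_ne_zero hq0 hq1 (j + 1)
  rw [qPoch_succ] at h2
  have h3 := left_ne_zero_of_mul h2
  have h4 := right_ne_zero_of_mul h2
  unfold qKrawWeight
  rw [show x + j - x = j by omega, show x + j + 1 - x = j + 1 by omega, qPoch_succ q q,
    qPoch_succ' q (p * q), pow_succ' q]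
  field_simp
  ring

/-- Summation by parts: the raising and lowering operators are adjoint to each other. -/
lemma sum_qKrawWeight_raise {q : ℝ} (hq0 : 0 < q) (hq1 : q < 1) (p : ℝ) (N : ℕ) (f g : ℤ → ℝ) :
    ∑ x ∈ Finset.range (N + 2), qKrawWeight q p (N + 1) x * f x *
        (q * (1 - p * q ^ ((N : ℤ) + 2 - x)) * (1 - q ^ (x : ℤ)) * g ((x : ℤ) - 1) +
          q ^ ((x : ℤ) + 1) * (1 - q ^ ((N : ℤ) + 1 - x)) * g x) =
      (1 - p * q) * ∑ x ∈ Finset.range (N + 1), qKrawWeight q (p * q) N x *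
        (q ^ ((x : ℤ) + 1) * (f (x + 1) - f x)) * g x := by
  simp only [mul_add, Finset.sum_add_distrib]
  rw [Finset.sum_range_succ', Finset.sum_range_succ _ (N + 1), Finset.mul_sum]
  simp only [Nat.cast_zero, zpow_zero, sub_self, mul_zero, zero_mul, add_zero, Nat.cast_add,
    Nat.cast_one]
  rw [← Finset.sum_add_distrib]
  refine Finset.sum_congr rfl fun x hx => ?_
  have hxN : x ≤ N := by simpa [Nat.lt_succ_iff] using hx
  have hA := qKrawWeight_succ_succ hq0 hq1 p hxN
  have hB := qKrawWeight_succ_left hq0 hq1 p hxN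
  have e1 : (q : ℝ) ^ ((N : ℤ) + 1 - x) = q ^ (N + 1 - x) := by
    rw [← zpow_natCast, Nat.cast_sub (by omega)]; push_cast; rfl
  have e2 : (N : ℤ) + 2 - (x + 1) = N + 1 - x := by ring
  have e3 : (q : ℝ) ^ ((x : ℤ) + 1) = q ^ (x + 1) := by exact_mod_cast zpow_natCast q (x + 1)
  rw [e2, e1, e3, add_sub_cancel_right]
  linear_combination q * f (x + 1) * g x * hA + q ^ (x + 1) * f x * g x * hB

lemma sum_qKrawWeight {q : ℝ} (hq0 : 0 < q) (hq1 : q < 1) (p : ℝ) (N : ℕ) :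
    ∑ x ∈ Finset.range (N + 1), qKrawWeight q p N x = qKrawNorm q p N 0 := by
  induction N with
  | zero => simp [qKrawWeight, qKrawNorm, qPoch_zero]
  | succ N ih =>
    have hN := qPoch_self_ne_zero hq0 hq1 (N + 1)
    rw [qPoch_succ] at hN
    have h1 := left_ne_zero_of_mul hN
    have h2 := right_ne_zero_of_mul hN
    have hstep : (1 - q ^ (N + 1)) * ∑ x ∈ Finset.range (N + 1 + 1), qKrawWeight q p (N + 1) x =
        p * q ^ (N + 1) * ∑ x ∈ Finset.range (N + 1), qKrawWeight q p N x := by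
      have hsplit : ∀ x ∈ Finset.range (N + 1 + 1), (1 - q ^ (N + 1)) * qKrawWeight q p (N + 1) x =
          (1 - q ^ x) * qKrawWeight q p (N + 1) x +
            q ^ x * (1 - q ^ (N + 1 - x)) * qKrawWeight q p (N + 1) x := by
        intro x hx
        have : (q : ℝ) ^ (N + 1) = q ^ x * q ^ (N + 1 - x) := by
          rw [← pow_add, Nat.add_sub_cancel' (by simpa [Nat.lt_succ_iff] using hx)]
        rw [this]; ring
      rw [Finset.mul_sum, Finset.sum_congr rfl hsplit, Finset.sum_add_distrib,
        Finset.sum_range_succ', Finset.sum_range_succ _ (N + 1)]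
      simp only [pow_zero, sub_self, Nat.sub_self, zero_mul, mul_zero, add_zero]
      rw [← Finset.sum_add_distrib, Finset.mul_sum]
      refine Finset.sum_congr rfl fun x hx => ?_
      obtain ⟨j, rfl⟩ := Nat.exists_eq_add_of_le (show x ≤ N by simpa [Nat.lt_succ_iff] using hx)
      have h1 := qPoch_self_ne_zero hq0 hq1 (x + 1)
      have h2 := qPoch_self_ne_zero hq0 hq1 (j + 1)
      rw [qPoch_succ] at h1 h2
      have h3 := left_ne_zero_of_mul h1
      have h4 := right_ne_zero_of_mul h1
      have h5 := left_ne_zero_of_mul h2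
      have h6 := right_ne_zero_of_mul h2
      unfold qKrawWeight
      rw [show x + j + 1 - (x + 1) = j by omega, show x + j - x = j by omega,
        show x + j + 1 - x = j + 1 by omega, qPoch_succ q q, qPoch_succ q q, qPoch_succ q (p * q),
        choose_two_succ, pow_succ' q x, pow_succ' q j]
      field_simp
      ring
    rw [ih] at hstep
    refine mul_left_cancel₀ h2 ?_
    rw [show 1 - q * q ^ N = 1 - q ^ (N + 1) by ring, hstep]
    unfold qKrawNorm
    simp only [Nat.sub_zero, qPoch_succ q q N, choose_two_succ (N + 1), qPoch_zero]
    push_cast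
    simp only [zpow_sub₀ hq0.ne', zpow_add₀ hq0.ne']
    field_simp
    norm_cast
    ring

lemma qKraw_degree_zero (q : ℝ) (x N : ℤ) (p : ℝ) : qKraw q 0 x N p = 1 := by
  simp [qKraw, qPoch_zero]

lemma sum_qKrawWeight_mul_succ {q : ℝ} (hq0 : 0 < q) (hq1 : q < 1) (p : ℝ) (N m : ℕ)
    (f : ℤ → ℝ) :
    q ^ ((N : ℤ) + 2 - m) * ∑ x ∈ Finset.range (N + 2),
        qKrawWeight q p (N + 1) x * f x * qKraw q (m + 1) x (N + 1) p =
      (1 - p * q) * ∑ x ∈ Finset.range (N + 1), qKrawWeight q (p * q) N x *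
        (q ^ ((x : ℤ) + 1) * (f (x + 1) - f x)) * qKraw q m x N (p * q) := by
  rw [← sum_qKrawWeight_raise hq0 hq1 p N f fun x => qKraw q m x N (p * q), Finset.mul_sum]
  refine Finset.sum_congr rfl fun x _ => ?_
  rw [qKraw_raise hq0 hq1]
  ring

lemma qKrawNorm_succ {q : ℝ} (hq0 : 0 < q) (p : ℝ) {N n : ℕ} (hn : n ≤ N) :
    q ^ ((N : ℤ) + 2 - n) * qKrawNorm q p (N + 1) (n + 1) =
      (1 - p * q) * (-(1 - q ^ (n + 1)) * p * q ^ (n + 1) * qKrawNorm q (p * q) N n) := by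
  obtain ⟨j, rfl⟩ := Nat.exists_eq_add_of_le hn
  unfold qKrawNorm
  rw [show n + j + 1 - (n + 1) = j by omega, show n + j - n = j by omega, qPoch_succ q q,
    qPoch_succ' q (p * q)]
  have hexp : q ^ (((n + j : ℕ) : ℤ) + 2 - n) *
      q ^ (((j + 1).choose 2 : ℤ) + ((n + 1 : ℕ) : ℤ) * ((n + 1 : ℕ) : ℤ) - 2 * ((n + 1 : ℕ) : ℤ)) =
      q ^ (n + 1) * q ^ (n + j) * q ^ (((j + 1).choose 2 : ℤ) + n * n - 2 * n) := by
    simp only [← zpow_natCast, ← zpow_add₀ hq0.ne']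
    congr 1
    push_cast
    ring
  rw [mul_pow p q, pow_succ (-1 : ℝ), pow_succ p]
  linear_combination -(-1) ^ n * ((1 - p * q) * qPoch q (p * q * q) n) *
    (qPoch q q n * (1 - q * q ^ n)) * (p ^ (n + j) * p) / qPoch q q j * hexp

/-- Orthogonality of the quantum q-Krawtchouk polynomials. -/
lemma qKraw_orthogonality {q : ℝ} (hq0 : 0 < q) (hq1 : q < 1) (p : ℝ) {N n m : ℕ}
    (hn : n ≤ N) (hm : m ≤ N) :
    ∑ x ∈ Finset.range (N + 1), qKrawWeight q p N x * qKraw q n x N p * qKraw q m x N p =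
      if n = m then qKrawNorm q p N n else 0 := by
  have hzero : ∀ {N m : ℕ} (p : ℝ), m + 1 ≤ N →
      ∑ x ∈ Finset.range (N + 1), qKrawWeight q p N x * qKraw q (m + 1) x N p = 0 := by
    intro N m p hm
    obtain ⟨N, rfl⟩ : ∃ k, N = k + 1 := ⟨N - 1, by omega⟩
    have h := sum_qKrawWeight_mul_succ hq0 hq1 p N m fun _ => 1
    simp only [sub_self, mul_zero, zero_mul, Finset.sum_const_zero, mul_one] at h
    push_cast
    exact (mul_eq_zero.mp h).resolve_left (zpow_ne_zero _ hq0.ne')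
  induction n generalizing N m p with
  | zero =>
    simp only [qKraw_degree_zero, mul_one]
    cases m with
    | zero => simpa [qKraw_degree_zero] using sum_qKrawWeight hq0 hq1 p N
    | succ m => simpa using hzero p hm
  | succ n ih =>
    cases m with
    | zero => simpa [qKraw_degree_zero] using hzero p hn
    | succ m =>
      obtain ⟨N, rfl⟩ : ∃ k, N = k + 1 := ⟨N - 1, by omega⟩
      have h := sum_qKrawWeight_mul_succ hq0 hq1 p N m fun x => qKraw q (n + 1) x (N + 1) p
      simp only [qKraw_lower hq0 hq1] at h
      have hih := ih (p * q) (N := N) (m := m) (by omega) (by omega)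
      refine mul_left_cancel₀ (zpow_ne_zero ((N : ℤ) + 2 - m) hq0.ne') ?_
      have hpull : ∑ x ∈ Finset.range (N + 1), qKrawWeight q (p * q) N x *
          (-(1 - q ^ (n + 1)) * p * q ^ (n + 1) * qKraw q n x N (p * q)) * qKraw q m x N (p * q) =
          -(1 - q ^ (n + 1)) * p * q ^ (n + 1) * ∑ x ∈ Finset.range (N + 1),
            qKrawWeight q (p * q) N x * qKraw q n x N (p * q) * qKraw q m x N (p * q) := by
        rw [Finset.mul_sum]
        exact Finset.sum_congr rfl fun x _ => by ring
      rw [hpull, hih] at h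
      push_cast
      rw [h]
      rcases eq_or_ne n m with rfl | hnm
      · simp only [if_true]
        rw [qKrawNorm_succ hq0 p (by omega)]
      · simp [hnm]

/-- Dual orthogonality of the quantum q-Krawtchouk polynomials. -/
lemma qKraw_dual_orthogonality {q p : ℝ} (hq0 : 0 < q) (hq1 : q < 1) {N x y : ℕ}
    (hp0 : p ≠ 0) (hp : ∀ k < N, p * q * q ^ k ≠ 1) (hx : x ≤ N) (hy : y ≤ N) :
    ∑ n ∈ Finset.range (N + 1), qKraw q n x N p * qKraw q n y N p / qKrawNorm q p N n =
      if x = y then (qKrawWeight q p N x)⁻¹ else 0 := by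
  let A : Matrix (Fin (N + 1)) (Fin (N + 1)) ℝ :=
    Matrix.of fun n x => qKrawWeight q p N x * qKraw q n x N p
  let B : Matrix (Fin (N + 1)) (Fin (N + 1)) ℝ :=
    Matrix.of fun x n => qKraw q n x N p / qKrawNorm q p N n
  have hAB : A * B = 1 := by
    ext n m
    have hn : (n : ℕ) ≤ N := by omega
    have hm : (m : ℕ) ≤ N := by omega
    have h := qKraw_orthogonality hq0 hq1 p hn hm
    have hm0 := qKrawNorm_ne_zero hq0 hq1 hm hp0 hp
    rw [Finset.sum_range] at h
    simp only [A, B, Matrix.mul_apply, Matrix.of_apply, ← mul_div_assoc]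
    rw [← Finset.sum_div, h, Matrix.one_apply]
    simp only [Fin.ext_iff]
    split_ifs with hnm
    · rw [hnm, div_self hm0]
    · exact zero_div _
  have hBA : B * A = 1 := mul_eq_one_comm.mp hAB
  replace hBA := congrFun (congrFun hBA ⟨y, by omega⟩) ⟨x, by omega⟩
  have hw := qKrawWeight_ne_zero hq0 hq1 (x := x) hp
  simp only [A, B, Matrix.mul_apply, Matrix.of_apply, Matrix.one_apply, Fin.mk.injEq] at hBA
  rw [Finset.sum_range]
  refine mul_left_cancel₀ hw ?_
  rw [Finset.mul_sum]
  convert hBA using 1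
  · exact Finset.sum_congr rfl fun n _ => by ring
  · rcases eq_or_ne x y with rfl | h
    · simp [hw]
    · simp [h, h.symm]

lemma Kq_natCast (q : ℝ) (n₁ n₂ : ℕ) (x₁ x₂ : ℤ) (θ φ : ℝ) (N : ℤ) :
    Kq q n₁ n₂ x₁ x₂ θ φ N = qKraw q n₁ x₁ (x₁ + x₂) (θ ^ 2)⁻¹ *
      qKraw q n₂ (x₁ + x₂ - n₁) (N - n₁) (φ ^ 2)⁻¹ := by
  simp [Kq]

lemma two_mul_choose_two (n : ℕ) : (2 : ℤ) * (n.choose 2 : ℕ) = n * (n - 1) := by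
  induction n with
  | zero => simp
  | succ n ih => rw [choose_two_succ]; push_cast; linarith

lemma natCast_mul_pred_div_two (n : ℕ) : (n : ℤ) * (n - 1) / 2 = (n.choose 2 : ℕ) := by
  rw [← two_mul_choose_two, Int.mul_ediv_cancel_left _ two_ne_zero]

/-- The part of the dual weight that does not depend on the second degree, once the norm of the
second univariate factor has been split off. -/
noncomputable def dualWeightFactor (q : ℝ) (N n : ℕ) (θ φ : ℝ) : ℝ :=
  (-1 : ℝ) ^ n * (φ ^ 2)⁻¹ ^ N *
    q ^ ((N : ℤ) * n + 2 * n + ((N - n + 1).choose 2 : ℕ) - 3 * (n.choose 2 : ℕ)) /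
    (qPoch q q N * qPoch q q n * qPoch q ((θ ^ 2)⁻¹ * q) n)

lemma Δdual_eq {q : ℝ} (hq0 : 0 < q) (hq1 : q < 1) {N n₁ n₂ : ℕ} {θ φ : ℝ} (hφ : φ ≠ 0)
    (hn : n₁ + n₂ ≤ N) (hp : ∀ k < N, (φ ^ 2)⁻¹ * q * q ^ k ≠ 1) :
    Δdual q N n₁ n₂ θ φ =
      dualWeightFactor q N n₁ θ φ / qKrawNorm q (φ ^ 2)⁻¹ (N - n₁) n₂ := by
  rw [eq_div_iff (qKrawNorm_ne_zero hq0 hq1 (by omega) (by positivity) fun k hk => hp k (by omega))]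
  obtain ⟨r, rfl⟩ := Nat.exists_eq_add_of_le hn
  have h1 := qPoch_self_ne_zero hq0 hq1 n₁
  have h2 := qPoch_self_ne_zero hq0 hq1 n₂
  have h3 := qPoch_self_ne_zero hq0 hq1 r
  have h4 := qPoch_self_ne_zero hq0 hq1 (n₁ + n₂ + r)
  have h5 : qPoch q ((φ ^ 2)⁻¹ * q) n₂ ≠ 0 := qPoch_ne_zero fun k hk => hp k (by omega)
  unfold Δdual qTrinom qKrawNorm dualWeightFactor
  simp only [natCast_mul_pred_div_two, mul_comm q]
  rw [show n₁ + n₂ + r - n₁ - n₂ = r by omega, show n₁ + n₂ + r - n₁ = n₂ + r by omega]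
  have hexp : q ^ (-((n₁ : ℤ) * (n₁ - 1)) - (n₂ : ℤ) * (n₂ - 1)) *
      q ^ (((n₁ + n₂ + r : ℕ) : ℤ) * (n₁ + n₂) + 2 * n₁ + n₂ - (n₁ : ℤ) * n₂ -
          (n₁.choose 2 : ℕ) - (n₂.choose 2 : ℕ)) *
      q ^ (((r + 1).choose 2 : ℤ) + n₂ * n₂ - 2 * n₂) =
      q ^ (((n₁ + n₂ + r : ℕ) : ℤ) * n₁ + 2 * n₁ + ((n₂ + r + 1).choose 2 : ℕ) -
        3 * (n₁.choose 2 : ℕ)) := by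
    simp only [← zpow_add₀ hq0.ne']
    congr 1
    have a1 := two_mul_choose_two n₁
    have a2 := two_mul_choose_two n₂
    have a3 := two_mul_choose_two (r + 1)
    have a4 := two_mul_choose_two (n₂ + r + 1)
    push_cast at *
    refine mul_left_cancel₀ (two_ne_zero (α := ℤ)) ?_
    linear_combination 2 * a1 - a2 + a3 - a4
  rw [← hexp]
  have hφn : φ ^ (-(2 * (n₁ : ℤ))) = (φ ^ 2)⁻¹ ^ n₁ := by
    rw [zpow_neg, inv_pow, ← pow_mul]; norm_cast
  have hsign : (-1 : ℝ) ^ n₂ * (-1) ^ n₂ = 1 := by rw [← mul_pow]; simp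
  rw [hφn, pow_add (-1 : ℝ), show n₁ + n₂ + r = n₁ + (n₂ + r) by ring, pow_add (φ ^ 2)⁻¹]
  generalize (φ ^ 2)⁻¹ = p at *
  rw [show n₁ + (n₂ + r) = n₁ + n₂ + r by ring]
  by_cases h6 : qPoch q ((θ ^ 2)⁻¹ * q) n₁ = 0
  · simp [h6]
  generalize qPoch q (p * q) n₂ = P at *
  generalize qPoch q ((θ ^ 2)⁻¹ * q) n₁ = Q at *
  field_simp
  linear_combination p ^ (n₁ + n₂ + r) * hsign

lemma dualWeightFactor_div {q : ℝ} (hq0 : 0 < q) (hq1 : q < 1) {N n X : ℕ} {θ φ : ℝ}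
    (hθ : θ ≠ 0) (hn : n ≤ X) (hX : X ≤ N) (hp : ∀ k < N, (θ ^ 2)⁻¹ * q * q ^ k ≠ 1) :
    dualWeightFactor q N n θ φ / qKrawWeight q (φ ^ 2)⁻¹ (N - n) (X - n) =
      (-1 : ℝ) ^ (N - X) * (φ ^ 2)⁻¹ ^ N * (θ ^ 2)⁻¹ ^ X * qPoch q q (N - X) *
        q ^ ((X : ℤ) + ((N + 1).choose 2 : ℕ)) / (qPoch q q N * qPoch q ((φ ^ 2)⁻¹ * q) (N - X)) /
        qKrawNorm q (θ ^ 2)⁻¹ X n := by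
  rw [eq_div_iff (qKrawNorm_ne_zero hq0 hq1 hn (by positivity) fun k hk => hp k (by omega))]
  have h5 : qPoch q ((θ ^ 2)⁻¹ * q) n ≠ 0 := qPoch_ne_zero fun k hk => hp k (by omega)
  obtain ⟨a, rfl⟩ := Nat.exists_eq_add_of_le hn
  obtain ⟨b, rfl⟩ := Nat.exists_eq_add_of_le hX
  have h1 := qPoch_self_ne_zero hq0 hq1 n
  have h2 := qPoch_self_ne_zero hq0 hq1 a
  have h3 := qPoch_self_ne_zero hq0 hq1 b
  have h4 := qPoch_self_ne_zero hq0 hq1 (n + a + b)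
  unfold dualWeightFactor qKrawWeight qKrawNorm
  rw [show n + a - n = a by omega, show n + a + b - n = a + b by omega,
    show a + b - a = b by omega, show n + a + b - (n + a) = b by omega]
  have hexp : q ^ (((n + a + b : ℕ) : ℤ) * n + 2 * n + ((a + b + 1).choose 2 : ℕ) -
        3 * (n.choose 2 : ℕ)) * q ^ (((a + 1).choose 2 : ℤ) + n * n - 2 * n) =
      q ^ (((n + a : ℕ) : ℤ) + ((n + a + b + 1).choose 2 : ℕ)) * q ^ a.choose 2 := by
    rw [← zpow_natCast q (a.choose 2)]
    simp only [← zpow_add₀ hq0.ne']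
    congr 1
    have a1 := two_mul_choose_two n
    have a2 := two_mul_choose_two a
    have a3 := two_mul_choose_two (a + 1)
    have a4 := two_mul_choose_two (a + b + 1)
    have a5 := two_mul_choose_two (n + a + b + 1)
    push_cast at *
    refine mul_left_cancel₀ (two_ne_zero (α := ℤ)) ?_
    linear_combination -3 * a1 - a2 + a3 + a4 - a5
  have hsign : (-1 : ℝ) ^ n * (-1) ^ n = 1 := by rw [← mul_pow]; simp
  generalize q ^ (_ - 3 * (n.choose 2 : ℤ)) = A at *
  generalize q ^ (((a + 1).choose 2 : ℤ) + n * n - 2 * n) = B at *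
  generalize q ^ (_ + ((n + a + b + 1).choose 2 : ℤ)) = C at *
  have hsign' : (-1 : ℝ) ^ b * (-1) ^ b = 1 := by rw [← mul_pow]; simp
  have hq : q ^ a.choose 2 ≠ 0 := pow_ne_zero _ hq0.ne'
  generalize (θ ^ 2)⁻¹ = u at *
  generalize (φ ^ 2)⁻¹ = v at *
  generalize q ^ a.choose 2 = D at *
  by_cases h6 : qPoch q (v * q) b = 0
  · simp [h6]
  field_simp
  rw [sq, sq, hsign, hsign']
  linear_combination v ^ (n + a + b) * u ^ (n + a) / qPoch q (q * v) b * hexp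

lemma Δw_mul {q : ℝ} (hq0 : 0 < q) (hq1 : q < 1) {N x₁ x₂ : ℕ} {θ φ : ℝ}
    (hθ : θ ≠ 0) (hφ : φ ≠ 0) (hx : x₁ + x₂ ≤ N) (hp : ∀ k < N, (φ ^ 2)⁻¹ * q * q ^ k ≠ 1) :
    Δw q N x₁ x₂ θ φ * ((-1 : ℝ) ^ (N - (x₁ + x₂)) * (φ ^ 2)⁻¹ ^ N * (θ ^ 2)⁻¹ ^ (x₁ + x₂) *
        qPoch q q (N - (x₁ + x₂)) * q ^ (((x₁ + x₂ : ℕ) : ℤ) + ((N + 1).choose 2 : ℕ)) /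
        (qPoch q q N * qPoch q ((φ ^ 2)⁻¹ * q) (N - (x₁ + x₂)))) =
      qKrawWeight q (θ ^ 2)⁻¹ (x₁ + x₂) x₁ := by
  have h5 : qPoch q ((φ ^ 2)⁻¹ * q) (N - (x₁ + x₂)) ≠ 0 :=
    qPoch_ne_zero fun k hk => hp k (by omega)
  obtain ⟨r, rfl⟩ := Nat.exists_eq_add_of_le hx
  have h1 := qPoch_self_ne_zero hq0 hq1 x₁
  have h2 := qPoch_self_ne_zero hq0 hq1 x₂
  have h3 := qPoch_self_ne_zero hq0 hq1 r
  have h4 := qPoch_self_ne_zero hq0 hq1 (x₁ + x₂ + r)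
  unfold Δw qTrinom qKrawWeight
  have hhalf : ((x₁ + x₂ + r : ℕ) : ℤ) * (((x₁ + x₂ + r : ℕ) : ℤ) + 1) / 2 =
      ((x₁ + x₂ + r + 1).choose 2 : ℕ) := by
    rw [← natCast_mul_pred_div_two]; push_cast; congr 1; ring
  have hsign : (-1 : ℝ) ^ r * (-1) ^ r = 1 := by rw [← mul_pow]; simp
  rw [hhalf, ← Nat.choose_two_right]
  rw [show x₁ + x₂ + r - x₁ - x₂ = r by omega, show x₁ + x₂ + r - x₁ = x₂ + r by omega,
    show x₁ + x₂ - x₁ = x₂ by omega, show x₁ + x₂ + r - (x₁ + x₂) = r by omega] at *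
  rw [pow_add (-1 : ℝ), pow_mul φ, zpow_add₀ hq0.ne', zpow_neg, zpow_natCast, zpow_natCast,
    mul_pow, inv_pow, inv_pow, inv_pow]
  have hq := hq0.ne'
  field_simp
  rw [sq, hsign, one_mul, mul_div_cancel_right₀]
  simpa [div_eq_inv_mul] using h5

/-- Dual orthogonality relation for the bivariate quantum q-Krawtchouk polynomials. -/
theorem dual_orthogonality (q : ℝ) (hq0 : 0 < q) (hq1 : q < 1)
    (N : ℕ) (hN : 0 < N) (θ φ : ℝ) (hθ : θ ≠ 0) (hφ : φ ≠ 0)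
    (hθq : ∀ j : ℤ, 1 ≤ j → j ≤ (N : ℤ) → θ ^ 2 ≠ q ^ j)
    (hφq : ∀ j : ℤ, 1 ≤ j → j ≤ (N : ℤ) → φ ^ 2 ≠ q ^ j)
    (x₁ x₂ y₁ y₂ : ℕ) (hx : x₁ + x₂ ≤ N) (hy : y₁ + y₂ ≤ N) :
    Δw q N x₁ x₂ θ φ *
      ∑ n₁ ∈ Finset.range (N + 1), ∑ n₂ ∈ Finset.range (N + 1 - n₁),
        Δdual q N n₁ n₂ θ φ * Kq q n₁ n₂ x₁ x₂ θ φ N * Kq q n₁ n₂ y₁ y₂ θ φ N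
      = if x₁ = y₁ ∧ x₂ = y₂ then 1 else 0 := by
  have hshift : ∀ t : ℝ, t ≠ 0 → (∀ j : ℤ, 1 ≤ j → j ≤ (N : ℤ) → t ^ 2 ≠ q ^ j) →
      ∀ k < N, (t ^ 2)⁻¹ * q * q ^ k ≠ 1 := by
    intro t ht h k hk heq
    refine h (k + 1) (by omega) (by omega) ?_
    have : q ^ ((k : ℤ) + 1) = q * q ^ k := by rw [zpow_add_one₀ hq0.ne', zpow_natCast, mul_comm]
    rw [this, ← mul_one (t ^ 2), ← heq]
    field_simp
  have hp₁ := hshift θ hθ hθq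
  have hp₂ := hshift φ hφ hφq
  have hp₁0 : (θ ^ 2)⁻¹ ≠ 0 := by positivity
  have hp₂0 : (φ ^ 2)⁻¹ ≠ 0 := by positivity
  clear hshift
  set X := x₁ + x₂ with hX
  set Y := y₁ + y₂ with hY
  set C := (-1 : ℝ) ^ (N - X) * (φ ^ 2)⁻¹ ^ N * (θ ^ 2)⁻¹ ^ X * qPoch q q (N - X) *
    q ^ ((X : ℤ) + ((N + 1).choose 2 : ℕ)) / (qPoch q q N * qPoch q ((φ ^ 2)⁻¹ * q) (N - X)) with hC
  have hxc : (x₁ : ℤ) + x₂ = X := by rw [hX]; push_cast; rfl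
  have hyc : (y₁ : ℤ) + y₂ = Y := by rw [hY]; push_cast; rfl
  have hinner : ∀ n₁ ∈ Finset.range (N + 1), ∑ n₂ ∈ Finset.range (N + 1 - n₁),
      Δdual q N n₁ n₂ θ φ * Kq q n₁ n₂ x₁ x₂ θ φ N * Kq q n₁ n₂ y₁ y₂ θ φ N =
      if X = Y then C * (qKraw q n₁ x₁ X (θ ^ 2)⁻¹ * qKraw q n₁ y₁ X (θ ^ 2)⁻¹ /
        qKrawNorm q (θ ^ 2)⁻¹ X n₁) else 0 := by
    intro n₁ hn₁
    have hn₁N : n₁ ≤ N := by simpa [Nat.lt_succ_iff] using hn₁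
    simp only [Kq_natCast, hxc, hyc]
    rcases lt_or_ge X n₁ with hXn | hXn
    · simp [qKraw_eq_zero hq0.ne' (show x₁ ≤ X by omega) hXn]
    rcases lt_or_ge Y n₁ with hYn | hYn
    · have hne : X ≠ Y := by omega
      simp [qKraw_eq_zero hq0.ne' (show y₁ ≤ Y by omega) hYn, hne]
    have hdual := qKraw_dual_orthogonality hq0 hq1 (N := N - n₁) (x := X - n₁) (y := Y - n₁)
      hp₂0 (fun k hk => hp₂ k (by omega)) (by omega) (by omega)
    have hterm : ∀ n₂ ∈ Finset.range (N + 1 - n₁), Δdual q N n₁ n₂ θ φ *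
        (qKraw q n₁ x₁ X (θ ^ 2)⁻¹ * qKraw q n₂ ((X : ℤ) - n₁) ((N : ℤ) - n₁) (φ ^ 2)⁻¹) *
        (qKraw q n₁ y₁ Y (θ ^ 2)⁻¹ * qKraw q n₂ ((Y : ℤ) - n₁) ((N : ℤ) - n₁) (φ ^ 2)⁻¹) =
        dualWeightFactor q N n₁ θ φ * qKraw q n₁ x₁ X (θ ^ 2)⁻¹ * qKraw q n₁ y₁ Y (θ ^ 2)⁻¹ *
        (qKraw q n₂ ((X - n₁ : ℕ) : ℤ) ((N - n₁ : ℕ) : ℤ) (φ ^ 2)⁻¹ *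
          qKraw q n₂ ((Y - n₁ : ℕ) : ℤ) ((N - n₁ : ℕ) : ℤ) (φ ^ 2)⁻¹ /
            qKrawNorm q (φ ^ 2)⁻¹ (N - n₁) n₂) := by
      intro n₂ hn₂
      have : n₁ + n₂ ≤ N := by have := Finset.mem_range.mp hn₂; omega
      rw [Δdual_eq hq0 hq1 hφ this hp₂, Nat.cast_sub hXn, Nat.cast_sub hYn, Nat.cast_sub hn₁N]
      ring
    rw [Finset.sum_congr rfl hterm, ← Finset.mul_sum, Nat.sub_add_comm hn₁N, hdual]
    rcases eq_or_ne X Y with hXY | hXY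
    · have h := dualWeightFactor_div (φ := φ) hq0 hq1 hθ hXn hx hp₁
      rw [← hC] at h
      rw [← hXY, if_pos rfl, if_pos rfl]
      linear_combination qKraw q n₁ x₁ X (θ ^ 2)⁻¹ * qKraw q n₁ y₁ X (θ ^ 2)⁻¹ * h
    · rw [if_neg (by omega), if_neg hXY, mul_zero]
  rw [Finset.sum_congr rfl hinner]
  rcases eq_or_ne X Y with hXY | hXY
  · simp only [if_pos hXY]
    rw [← Finset.mul_sum, ← mul_assoc, Δw_mul hq0 hq1 hθ hφ hx hp₂,
      ← Finset.sum_subset (Finset.range_subset_range.mpr (show X + 1 ≤ N + 1 by omega)),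
      qKraw_dual_orthogonality hq0 hq1 hp₁0 (fun k hk => hp₁ k (by omega)) (by omega) (by omega)]
    · rcases eq_or_ne x₁ y₁ with h | h
      · rw [if_pos h, if_pos ⟨h, by omega⟩,
          mul_inv_cancel₀ (qKrawWeight_ne_zero hq0 hq1 fun k hk => hp₁ k (by omega))]
      · rw [if_neg h, if_neg fun h' => h h'.1, mul_zero]
    · intro n _ hn
      rw [qKraw_eq_zero hq0.ne' (show x₁ ≤ X by omega) (by simpa using hn), zero_mul, zero_div]
  · simp only [if_neg hXY, Finset.sum_const_zero, mul_zero]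
    rw [if_neg]
    rintro ⟨rfl, rfl⟩
    exact hXY rfl
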